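/- Let n ≥ 2 be an integer. For all t ∈ (0,2) and a ∈ (0,π), the quantity F(t,a) = g_n(t) + K(n,a) + (B_{cos²(a/2)}(n/2,n/2)/B_{sin²(a/2)}(n/2,n/2)) · (g_n(√(4 − t²)) + K(n,π−a)) is nonnegative. -/

import Mathlib

open MeasureTheory Real Filter
open scoped RealInnerProductSpace

noncomputable def poch (x : ℝ) (k : ℕ) : ℝ := ∏ i ∈ Finset.range k, (x + i)

noncomputable def incBeta (x α β : ℝ) : ℝ := ∫ t in (0:ℝ)..x, t ^ (α - 1) * (1 - t) ^ (β - 1)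

noncomputable def sphereVol (n : ℕ) : ℝ :=
  2 * Real.pi ^ (((n : ℝ) + 1) / 2) / Real.Gamma (((n : ℝ) + 1) / 2)

noncomputable def green (n : ℕ) (t : ℝ) : ℝ :=
  2 / (n * sphereVol n) * ∑' k : ℕ,
    poch n k / (((k : ℝ) + 1) * poch ((n : ℝ) / 2 + 1) k) *
      ((1 - t ^ 2 / 4) ^ (k + 1)
        - incBeta 1 ((n : ℝ) / 2) ((n : ℝ) / 2 + k + 1) / incBeta 1 ((n : ℝ) / 2) ((n : ℝ) / 2))

noncomputable def Kfun (n : ℕ) (a : ℝ) : ℝ :=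
  2 / (n * sphereVol n) * ∑' k : ℕ,
    poch n k / (poch ((n : ℝ) / 2 + 1) k * ((k : ℝ) + 1)) *
      (incBeta (Real.sin (a / 2) ^ 2) ((n : ℝ) / 2 + k + 1) ((n : ℝ) / 2) /
        incBeta (Real.sin (a / 2) ^ 2) ((n : ℝ) / 2) ((n : ℝ) / 2))

noncomputable def ballVol (n : ℕ) (a : ℝ) : ℝ :=
  sphereVol (n - 1) * ∫ r in (0:ℝ)..a, Real.sin r ^ (n - 1)

noncomputable def sphereMeasure (n : ℕ) :
    Measure (Metric.sphere (0 : EuclideanSpace ℝ (Fin (n + 1))) 1) :=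
  (volume : Measure (EuclideanSpace ℝ (Fin (n + 1)))).toSphere


lemma poch_succ (x : ℝ) (k : ℕ) : poch x (k + 1) = poch x k * (x + k) :=
  Finset.prod_range_succ _ _

lemma poch_pos {x : ℝ} (hx : 0 < x) (k : ℕ) : 0 < poch x k :=
  Finset.prod_pos fun _ _ => by positivity

/-- The coefficients of `₂F₁(2m, 1; m + 1; x)`. -/
noncomputable def hyperCoeff (m : ℝ) (k : ℕ) : ℝ := poch (2 * m) k / poch (m + 1) k

lemma hyperCoeff_pos {m : ℝ} (hm : 1 ≤ m) (k : ℕ) : 0 < hyperCoeff m k :=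
  div_pos (poch_pos (by linarith) k) (poch_pos (by linarith) k)

lemma hyperCoeff_zero (m : ℝ) : hyperCoeff m 0 = 1 := by simp [hyperCoeff, poch]

lemma hyperCoeff_succ {m : ℝ} (hm : 1 ≤ m) (k : ℕ) :
    hyperCoeff m (k + 1) * (m + k + 1) = hyperCoeff m k * (2 * m + k) := by
  have h1 := (poch_pos (show 0 < m + 1 by linarith) k).ne'
  have h2 : m + 1 + k ≠ 0 := by positivity
  simp only [hyperCoeff, poch_succ]
  field_simp
  ring

lemma summable_succ_mul_hyperCoeff {m r : ℝ} (hm : 1 ≤ m) (hr : 0 < r) (hr1 : r < 1) :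
    Summable fun k : ℕ => ((k : ℝ) + 1) * hyperCoeff m k * r ^ k := by
  have hpos : ∀ k : ℕ, 0 < ((k : ℝ) + 1) * hyperCoeff m k * r ^ k := fun k => by
    have := hyperCoeff_pos hm k
    positivity
  refine summable_of_ratio_test_tendsto_lt_one hr1 (Eventually.of_forall fun k => (hpos k).ne') ?_
  have e : ∀ k : ℕ, (1 + 1 / ((k : ℝ) + 1)) * (1 + (m - 1) * (1 / (m + 1 + k))) * r =
      ‖(((k + 1 : ℕ) : ℝ) + 1) * hyperCoeff m (k + 1) * r ^ (k + 1)‖ /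
        ‖((k : ℝ) + 1) * hyperCoeff m k * r ^ k‖ := fun k => by
    have h1 := hyperCoeff_pos hm k
    have h3 : 0 < m + k + 1 := by positivity
    rw [Real.norm_of_nonneg (hpos (k + 1)).le, Real.norm_of_nonneg (hpos k).le,
      eq_div_of_mul_eq h3.ne' (hyperCoeff_succ hm k)]
    have h4 : m + 1 + k ≠ 0 := by positivity
    push_cast
    field_simp
    ring
  refine Tendsto.congr e ?_
  have t1 : Tendsto (fun k : ℕ => 1 / ((k : ℝ) + 1)) atTop (nhds 0) :=
    tendsto_one_div_add_atTop_nhds_zero_nat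
  have t2 : Tendsto (fun k : ℕ => 1 / (m + 1 + (k : ℝ))) atTop (nhds 0) := by
    simp only [one_div]
    exact tendsto_inv_atTop_zero.comp (tendsto_atTop_add_const_left _ _ tendsto_natCast_atTop_atTop)
  simpa using ((t1.const_add 1).mul ((t2.const_mul (m - 1)).const_add 1)).mul_const r

lemma summable_hyperCoeff_mul_pow {m x : ℝ} (hm : 1 ≤ m) (hx : |x| < 1) :
    Summable fun k : ℕ => hyperCoeff m k * x ^ k := by
  obtain ⟨r, hr, hr1⟩ := exists_between hx
  have hr0 : 0 < r := (abs_nonneg x).trans_lt hr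
  refine Summable.of_norm_bounded (summable_succ_mul_hyperCoeff hm hr0 hr1) fun k => ?_
  have h1 := hyperCoeff_pos hm k
  rw [norm_mul, norm_pow, Real.norm_of_nonneg h1.le, Real.norm_eq_abs]
  gcongr
  nlinarith [k.cast_nonneg (α := ℝ)]

/-- The hypergeometric function `₂F₁(2m, 1; m + 1; x)`. -/
noncomputable def hyper (m x : ℝ) : ℝ := ∑' k : ℕ, hyperCoeff m k * x ^ k

/-- The coefficients of `hyperPrim`. -/
noncomputable def primCoeff (m : ℝ) (k : ℕ) : ℝ := hyperCoeff m k / ((k : ℝ) + 1)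

lemma primCoeff_pos {m : ℝ} (hm : 1 ≤ m) (k : ℕ) : 0 < primCoeff m k :=
  div_pos (hyperCoeff_pos hm k) (by positivity)

lemma primCoeff_le {m : ℝ} (hm : 1 ≤ m) (k : ℕ) : primCoeff m k ≤ hyperCoeff m k :=
  div_le_self (hyperCoeff_pos hm k).le (by linarith [k.cast_nonneg (α := ℝ)])

/-- The primitive of `hyper m` vanishing at `0`. -/
noncomputable def hyperPrim (m x : ℝ) : ℝ := ∑' k : ℕ, primCoeff m k * x ^ (k + 1)

lemma summable_primCoeff_mul_pow {m x : ℝ} (hm : 1 ≤ m) (hx : |x| < 1) :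
    Summable fun k : ℕ => primCoeff m k * x ^ (k + 1) := by
  refine Summable.of_norm_bounded
    (summable_hyperCoeff_mul_pow hm (x := |x|) (by rwa [abs_abs])) fun k => ?_
  have h1 := primCoeff_pos hm k
  rw [norm_mul, norm_pow, Real.norm_of_nonneg h1.le, Real.norm_eq_abs, pow_succ]
  exact mul_le_mul (primCoeff_le hm k) (mul_le_of_le_one_right (by positivity) hx.le)
    (by positivity) (hyperCoeff_pos hm k).le

lemma hasDerivAt_hyperPrim {m x : ℝ} (hm : 1 ≤ m) (hx : |x| < 1) :
    HasDerivAt (hyperPrim m) (hyper m x) x := by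
  obtain ⟨r, hr, hr1⟩ := exists_between hx
  have hr0 : 0 < r := (abs_nonneg x).trans_lt hr
  refine hasDerivAt_tsum_of_isPreconnected (t := Set.Ioo (-r) r) (y₀ := 0)
    (summable_hyperCoeff_mul_pow hm (x := r) (by rwa [abs_of_pos hr0])) isOpen_Ioo
    isPreconnected_Ioo (g := fun k y => primCoeff m k * y ^ (k + 1))
    (g' := fun k y => hyperCoeff m k * y ^ k) (fun k y _ => ?_) (fun k y hy => ?_) (by simp [hr0])
    (summable_primCoeff_mul_pow hm (by simp)) (abs_lt.1 hr)
  · refine ((hasDerivAt_pow (k + 1) y).const_mul (primCoeff m k)).congr_deriv ?_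
    simp only [primCoeff]
    push_cast
    field_simp
  · have h1 := hyperCoeff_pos hm k
    rw [norm_mul, norm_pow, Real.norm_of_nonneg h1.le, Real.norm_eq_abs]
    gcongr
    exact (abs_lt.2 hy).le

lemma summable_hyperDeriv {m x : ℝ} (hm : 1 ≤ m) (hx : |x| < 1) :
    Summable fun k : ℕ => ((k : ℝ) + 1) * hyperCoeff m (k + 1) * x ^ k := by
  obtain ⟨r, hr, hr1⟩ := exists_between hx
  have hr0 : 0 < r := (abs_nonneg x).trans_lt hr
  refine Summable.of_norm_bounded
    (((summable_nat_add_iff 1).2 (summable_succ_mul_hyperCoeff hm hr0 hr1)).mul_left r⁻¹)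
    fun k => ?_
  have h1 := hyperCoeff_pos hm (k + 1)
  rw [norm_mul, norm_pow, Real.norm_of_nonneg (by positivity), Real.norm_eq_abs]
  calc ((k : ℝ) + 1) * hyperCoeff m (k + 1) * |x| ^ k
      ≤ ((k + 1 : ℕ) + 1 : ℝ) * hyperCoeff m (k + 1) * r ^ k := by
        gcongr
        linarith
    _ = _ := by
        rw [pow_succ]
        field_simp

lemma hasDerivAt_hyper {m x : ℝ} (hm : 1 ≤ m) (hx : |x| < 1) :
    HasDerivAt (hyper m) (∑' k : ℕ, ((k : ℝ) + 1) * hyperCoeff m (k + 1) * x ^ k) x := by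
  obtain ⟨r, hr, hr1⟩ := exists_between hx
  have hr0 : 0 < r := (abs_nonneg x).trans_lt hr
  have key : HasDerivAt (fun y => ∑' k : ℕ, hyperCoeff m (k + 1) * y ^ (k + 1))
      (∑' k : ℕ, ((k : ℝ) + 1) * hyperCoeff m (k + 1) * x ^ k) x := by
    refine hasDerivAt_tsum_of_isPreconnected (t := Set.Ioo (-r) r) (y₀ := 0)
      (summable_hyperDeriv hm (x := r) (by rwa [abs_of_pos hr0])) isOpen_Ioo
      isPreconnected_Ioo (g := fun k y => hyperCoeff m (k + 1) * y ^ (k + 1))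
      (g' := fun k y => ((k : ℝ) + 1) * hyperCoeff m (k + 1) * y ^ k)
      (fun k y _ => ?_) (fun k y hy => ?_) (by simp [hr0])
      (by simp [summable_zero]) (abs_lt.1 hr)
    · refine ((hasDerivAt_pow (k + 1) y).const_mul (hyperCoeff m (k + 1))).congr_deriv ?_
      push_cast
      ring
    · have h1 := hyperCoeff_pos hm (k + 1)
      rw [norm_mul, norm_pow, Real.norm_of_nonneg (by positivity), Real.norm_eq_abs]
      gcongr
      exact (abs_lt.2 hy).le
  refine (key.const_add 1).congr_of_eventuallyEq ?_
  filter_upwards [isOpen_Ioo.mem_nhds (abs_lt.1 hx)] with y hy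
  have := (summable_hyperCoeff_mul_pow hm (abs_lt.2 hy)).tsum_eq_zero_add
  simpa [hyper, hyperCoeff_zero] using this

lemma hyper_ode {m x : ℝ} (hm : 1 ≤ m) (hx : |x| < 1) :
    x * (1 - x) * (∑' k : ℕ, ((k : ℝ) + 1) * hyperCoeff m (k + 1) * x ^ k)
      + m * (1 - 2 * x) * hyper m x = m := by
  set D := ∑' k : ℕ, ((k : ℝ) + 1) * hyperCoeff m (k + 1) * x ^ k with hD
  have s0 := summable_hyperCoeff_mul_pow hm hx
  have s1 : Summable fun k : ℕ => hyperCoeff m (k + 1) * x ^ (k + 1) := (summable_nat_add_iff 1).2 s0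
  have sD := summable_hyperDeriv hm hx
  have e1 : hyper m x = 1 + ∑' k : ℕ, hyperCoeff m (k + 1) * x ^ (k + 1) := by
    have := s0.tsum_eq_zero_add
    simpa [hyper, hyperCoeff_zero] using this
  have sE : Summable fun k : ℕ => (k : ℝ) * hyperCoeff m k * x ^ k := by
    refine (summable_nat_add_iff 1).1 ((sD.mul_left x).congr fun k => ?_)
    push_cast
    ring
  have e2 : x * D = ∑' k : ℕ, (k : ℝ) * hyperCoeff m k * x ^ k := by
    rw [sE.tsum_eq_zero_add, hD, ← tsum_mul_left]
    simp only [Nat.cast_zero, zero_mul, zero_add]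
    refine tsum_congr fun k => ?_
    push_cast
    ring
  have e3 : x * D + m * ∑' k : ℕ, hyperCoeff m (k + 1) * x ^ (k + 1) =
      x * (x * D) + 2 * m * x * hyper m x := by
    rw [e2]
    conv_lhs => rw [← e2, hD]
    rw [hyper, ← tsum_mul_left, ← tsum_mul_left, ← tsum_mul_left, ← tsum_mul_left,
      ← (sD.mul_left x).tsum_add (s1.mul_left m), ← (sE.mul_left x).tsum_add (s0.mul_left _)]
    refine tsum_congr fun k => ?_
    linear_combination x ^ (k + 1) * hyperCoeff_succ hm k
  linear_combination e3 + m * e1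

lemma continuous_betaIntegrand {α β : ℝ} (hα : 1 ≤ α) (hβ : 1 ≤ β) :
    Continuous fun t : ℝ => t ^ (α - 1) * (1 - t) ^ (β - 1) :=
  (continuous_id.rpow_const fun _ => Or.inr (by linarith)).mul
    ((continuous_const.sub continuous_id).rpow_const fun _ => Or.inr (by linarith))

lemma hasDerivAt_incBeta {α β : ℝ} (hα : 1 ≤ α) (hβ : 1 ≤ β) (s : ℝ) :
    HasDerivAt (fun s => incBeta s α β) (s ^ (α - 1) * (1 - s) ^ (β - 1)) s :=
  have h := continuous_betaIntegrand hα hβ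
  intervalIntegral.integral_hasDerivAt_right (h.intervalIntegrable _ _)
    h.aestronglyMeasurable.stronglyMeasurableAtFilter h.continuousAt

lemma continuous_incBeta {α β : ℝ} (hα : 1 ≤ α) (hβ : 1 ≤ β) :
    Continuous fun s => incBeta s α β :=
  continuous_iff_continuousAt.2 fun s => (hasDerivAt_incBeta hα hβ s).continuousAt

lemma incBeta_zero (α β : ℝ) : incBeta 0 α β = 0 := by simp [incBeta]

lemma incBeta_strictMonoOn {α β : ℝ} (hα : 1 ≤ α) (hβ : 1 ≤ β) :
    StrictMonoOn (fun s => incBeta s α β) (Set.Icc 0 1) := by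
  refine strictMonoOn_of_deriv_pos (convex_Icc 0 1) (continuous_incBeta hα hβ).continuousOn ?_
  intro s hs
  rw [interior_Icc] at hs
  rw [(hasDerivAt_incBeta hα hβ s).deriv]
  exact mul_pos (Real.rpow_pos_of_pos hs.1 _) (Real.rpow_pos_of_pos (by linarith [hs.2]) _)

lemma incBeta_pos {α β s : ℝ} (hα : 1 ≤ α) (hβ : 1 ≤ β) (hs : s ∈ Set.Ioc 0 1) :
    0 < incBeta s α β := by
  have := incBeta_strictMonoOn hα hβ (Set.left_mem_Icc.2 zero_le_one) ⟨hs.1.le, hs.2⟩ hs.1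
  simpa [incBeta_zero] using this

lemma incBeta_nonneg {α β s : ℝ} (hα : 1 ≤ α) (hβ : 1 ≤ β) (hs : s ∈ Set.Icc 0 1) :
    0 ≤ incBeta s α β := by
  have := (incBeta_strictMonoOn hα hβ).monotoneOn (Set.left_mem_Icc.2 zero_le_one) hs hs.1
  simpa [incBeta_zero] using this

lemma incBeta_one_comm (α β : ℝ) : incBeta 1 α β = incBeta 1 β α := by
  have h := intervalIntegral.integral_comp_sub_left
    (fun t : ℝ => t ^ (β - 1) * (1 - t) ^ (α - 1)) (a := 0) (b := 1) 1
  simp only [sub_sub_cancel, sub_self, sub_zero] at h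
  rw [incBeta, incBeta, ← h]
  simp only [mul_comm]

lemma incBeta_add_incBeta_one_sub {m : ℝ} (hm : 1 ≤ m) (s : ℝ) :
    incBeta s m m + incBeta (1 - s) m m = incBeta 1 m m := by
  have hc := continuous_betaIntegrand hm hm
  have h := intervalIntegral.integral_comp_sub_left
    (fun t : ℝ => t ^ (m - 1) * (1 - t) ^ (m - 1)) (a := s) (b := 1) 1
  simp only [sub_sub_cancel, sub_self] at h
  have e : incBeta (1 - s) m m = ∫ t in s..1, t ^ (m - 1) * (1 - t) ^ (m - 1) := by
    rw [incBeta, ← h]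
    simp only [mul_comm]
  rw [e]
  exact intervalIntegral.integral_add_adjacent_intervals (hc.intervalIntegrable _ _)
    (hc.intervalIntegrable _ _)

lemma incBeta_one_add_one_left {α β : ℝ} (hα : 1 ≤ α) (hβ : 1 ≤ β) :
    (α + β) * incBeta 1 (α + 1) β = α * incBeta 1 α β := by
  have c1 := (continuous_betaIntegrand hα hβ).const_mul α
  have c2 := (continuous_betaIntegrand (show 1 ≤ α + 1 by linarith) hβ).const_mul (α + β)
  have h : ∫ t in (0 : ℝ)..1, (α * (t ^ (α - 1) * (1 - t) ^ (β - 1))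
      - (α + β) * (t ^ (α + 1 - 1) * (1 - t) ^ (β - 1))) =
      (1 : ℝ) ^ α * (1 - 1) ^ β - (0 : ℝ) ^ α * (1 - 0) ^ β := by
    refine intervalIntegral.integral_eq_sub_of_hasDerivAt_of_le zero_le_one
      (f := fun t : ℝ => t ^ α * (1 - t) ^ β) ?_ ?_ ((c1.sub c2).intervalIntegrable _ _)
    · exact ((continuous_id.rpow_const fun _ => Or.inr (by linarith)).mul
        ((continuous_const.sub continuous_id).rpow_const fun _ => Or.inr (by linarith))).continuousOn
    · intro t ht
      have h0 : t ≠ 0 := ht.1.ne'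
      have h1 : 1 - t ≠ 0 := by linarith [ht.2]
      refine ((Real.hasDerivAt_rpow_const (Or.inl h0)).mul
        (((hasDerivAt_id t).const_sub 1).rpow_const (Or.inl h1))).congr_deriv ?_
      simp only [id, add_sub_cancel_right]
      rw [Real.rpow_sub_one h0, Real.rpow_sub_one h1]
      field_simp
      ring
  rw [intervalIntegral.integral_sub (c1.intervalIntegrable _ _) (c2.intervalIntegrable _ _),
    intervalIntegral.integral_const_mul, intervalIntegral.integral_const_mul, sub_self,
    Real.zero_rpow (by linarith), Real.zero_rpow (by linarith)] at h
  unfold incBeta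
  linarith

lemma hyperCoeff_mul_incBeta_one {m : ℝ} (hm : 1 ≤ m) (k : ℕ) :
    hyperCoeff m k * (2 * m + k) * incBeta 1 (m + k + 1) m = 2 * m * incBeta 1 (m + 1) m := by
  induction k with
  | zero => simp [hyperCoeff_zero]
  | succ k ih =>
    have h1 := hyperCoeff_succ hm k
    have h2 := incBeta_one_add_one_left (α := m + k + 1) (by linarith [k.cast_nonneg (α := ℝ)]) hm
    have h3 : m + k + 1 ≠ 0 := by positivity
    rw [← ih, eq_div_of_mul_eq h3 h1]
    push_cast
    rw [show m + ((k : ℝ) + 1) + 1 = m + k + 1 + 1 by ring,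
      div_mul_eq_mul_div, div_mul_eq_mul_div, div_eq_iff h3]
    linear_combination (2 * m + k) * hyperCoeff m k * h2

lemma summable_primCoeff_mul_incBeta_one {m : ℝ} (hm : 1 ≤ m) :
    Summable fun k : ℕ => primCoeff m k * incBeta 1 (m + k + 1) m := by
  have s : Summable fun k : ℕ => 1 / (((k + 1 : ℕ) : ℝ) ^ 2) :=
    (summable_nat_add_iff 1).2 (Real.summable_one_div_nat_pow.2 one_lt_two)
  have hk : ∀ k : ℕ, 1 ≤ m + k + 1 := fun k => by linarith [k.cast_nonneg (α := ℝ)]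
  refine Summable.of_nonneg_of_le (fun k => mul_nonneg (primCoeff_pos hm k).le
    (incBeta_nonneg (hk k) hm (by simp))) (fun k => ?_) (s.mul_left (2 * m * incBeta 1 (m + 1) m))
  have hpos : 0 ≤ 2 * m * incBeta 1 (m + 1) m :=
    mul_nonneg (by linarith) (incBeta_nonneg (by linarith) hm (by simp))
  have h3 : 0 < 2 * m + k := by positivity
  have h4 : hyperCoeff m k * incBeta 1 (m + k + 1) m = 2 * m * incBeta 1 (m + 1) m / (2 * m + k) := by
    rw [eq_div_iff h3.ne', ← hyperCoeff_mul_incBeta_one hm k]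
    ring
  rw [primCoeff, div_mul_eq_mul_div, h4, mul_one_div, div_div]
  gcongr
  push_cast
  nlinarith [k.cast_nonneg (α := ℝ)]

/-- The integral of `hyperPrim m` over `(0, s)` against the beta weight, as a series. -/
noncomputable def weightedPrim (m s : ℝ) : ℝ :=
  ∑' k : ℕ, primCoeff m k * incBeta s (m + k + 1) m

lemma weightedPrim_zero (m : ℝ) : weightedPrim m 0 = 0 := by simp [weightedPrim, incBeta_zero]

lemma norm_primCoeff_mul_incBeta_le {m s : ℝ} (hm : 1 ≤ m) (hs : s ∈ Set.Icc 0 1) (k : ℕ) :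
    ‖primCoeff m k * incBeta s (m + k + 1) m‖ ≤ primCoeff m k * incBeta 1 (m + k + 1) m := by
  have hk : 1 ≤ m + k + 1 := by linarith [k.cast_nonneg (α := ℝ)]
  have h1 := incBeta_nonneg hk hm hs
  have h2 := primCoeff_pos hm k
  rw [Real.norm_of_nonneg (by positivity)]
  gcongr
  exact (incBeta_strictMonoOn hk hm).monotoneOn hs (Set.right_mem_Icc.2 zero_le_one) hs.2

lemma continuousOn_weightedPrim {m : ℝ} (hm : 1 ≤ m) :
    ContinuousOn (weightedPrim m) (Set.Icc 0 1) :=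
  continuousOn_tsum (fun k => (continuous_const.mul (continuous_incBeta
    (by linarith [k.cast_nonneg (α := ℝ)]) hm)).continuousOn)
    (summable_primCoeff_mul_incBeta_one hm) fun k _ hs => norm_primCoeff_mul_incBeta_le hm hs k

lemma hasDerivAt_weightedPrim {m s : ℝ} (hm : 1 ≤ m) (hs : s ∈ Set.Ioo 0 1) :
    HasDerivAt (weightedPrim m) (hyperPrim m s * (s ^ (m - 1) * (1 - s) ^ (m - 1))) s := by
  obtain ⟨r, hr, hr1⟩ := exists_between hs.2
  have hr0 : 0 < r := hs.1.trans hr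
  have hk : ∀ k : ℕ, 1 ≤ m + k + 1 := fun k => by linarith [k.cast_nonneg (α := ℝ)]
  have e : ∀ k : ℕ, ∀ y ∈ Set.Ioo 0 r, y ^ (m + k + 1 - 1) * (1 - y) ^ (m - 1) =
      y ^ (k + 1) * (y ^ (m - 1) * (1 - y) ^ (m - 1)) := fun k y hy => by
    rw [← mul_assoc, show m + k + 1 - 1 = ((k + 1 : ℕ) : ℝ) + (m - 1) by push_cast; ring,
      Real.rpow_add hy.1, Real.rpow_natCast]
  refine (hasDerivAt_tsum_of_isPreconnected (t := Set.Ioo 0 r) (y₀ := s)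
    (summable_primCoeff_mul_pow hm (x := r) (by rwa [abs_of_pos hr0])) isOpen_Ioo
    isPreconnected_Ioo (g := fun k y => primCoeff m k * incBeta y (m + k + 1) m)
    (fun k y _ => (hasDerivAt_incBeta (hk k) hm y).const_mul _) (fun k y hy => ?_) ⟨hs.1, hr⟩
    (Summable.of_norm_bounded (summable_primCoeff_mul_incBeta_one hm)
      (norm_primCoeff_mul_incBeta_le hm ⟨hs.1.le, hs.2.le⟩)) ⟨hs.1, hr⟩).congr_deriv ?_
  · have h1 := primCoeff_pos hm k
    have h2 := hy.1
    have h3 : 0 < 1 - y := by linarith [hy.2]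
    rw [e k y hy, Real.norm_of_nonneg (by positivity)]
    have h4 : y ^ (m - 1) * (1 - y) ^ (m - 1) ≤ 1 :=
      mul_le_one₀ (Real.rpow_le_one h2.le (by linarith [hy.2]) (by linarith)) (by positivity)
        (Real.rpow_le_one h3.le (by linarith) (by linarith))
    calc primCoeff m k * (y ^ (k + 1) * (y ^ (m - 1) * (1 - y) ^ (m - 1)))
        ≤ primCoeff m k * (y ^ (k + 1) * 1) := by gcongr
      _ ≤ primCoeff m k * r ^ (k + 1) := by
        rw [mul_one]
        gcongr
        exact hy.2.le
  · rw [hyperPrim, ← tsum_mul_right]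
    refine tsum_congr fun k => ?_
    rw [e k s ⟨hs.1, hr⟩]
    ring

lemma hasDerivAt_incBeta_one_sub {m : ℝ} (hm : 1 ≤ m) (s : ℝ) :
    HasDerivAt (fun s => incBeta (1 - s) m m) (-(s ^ (m - 1) * (1 - s) ^ (m - 1))) s := by
  refine ((hasDerivAt_incBeta hm hm (1 - s)).comp_const_sub 1 s).congr_deriv ?_
  rw [sub_sub_cancel, mul_comm]

lemma hasDerivAt_weightedPrim_one_sub {m s : ℝ} (hm : 1 ≤ m) (hs : s ∈ Set.Ioo 0 1) :
    HasDerivAt (fun s => weightedPrim m (1 - s))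
      (-(hyperPrim m (1 - s) * (s ^ (m - 1) * (1 - s) ^ (m - 1)))) s := by
  refine ((hasDerivAt_weightedPrim hm (s := 1 - s)
    ⟨by linarith [hs.2], by linarith [hs.1]⟩).comp_const_sub 1 s).congr_deriv ?_
  rw [sub_sub_cancel, mul_comm (s ^ (m - 1))]

lemma abs_lt_one_of_mem_Ioo {x : ℝ} (hx : x ∈ Set.Ioo 0 1) : |x| < 1 := by
  rw [abs_of_pos hx.1]
  exact hx.2

lemma rpow_mul_hyper_eq_incBeta {m x : ℝ} (hm : 1 ≤ m) (hx : x ∈ Set.Ioo 0 1) :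
    x ^ m * (1 - x) ^ m * hyper m x = m * incBeta x m m := by
  have habs : ∀ y ∈ Set.Icc 0 x, |y| < 1 := fun y hy =>
    abs_lt.2 ⟨by linarith [hy.1], by linarith [hy.2, hx.2]⟩
  have hc : ContinuousOn (fun y => y ^ m * (1 - y) ^ m * hyper m y - m * incBeta y m m)
      (Set.Icc 0 x) := by
    refine ContinuousOn.sub (ContinuousOn.mul (Continuous.continuousOn
      ((continuous_id.rpow_const fun _ => Or.inr (by linarith)).mul
        ((continuous_const.sub continuous_id).rpow_const fun _ => Or.inr (by linarith))))
      fun y hy => (hasDerivAt_hyper hm (habs y hy)).continuousAt.continuousWithinAt)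
      (continuous_const.mul (continuous_incBeta hm hm)).continuousOn
  have hd : ∀ y ∈ Set.Ioo 0 x,
      HasDerivAt (fun y => y ^ m * (1 - y) ^ m * hyper m y - m * incBeta y m m) 0 y := by
    intro y hy
    have h0 : y ≠ 0 := hy.1.ne'
    have h1 : 1 - y ≠ 0 := by linarith [hy.2, hx.2]
    have hy1 := habs y ⟨hy.1.le, hy.2.le⟩
    refine ((((Real.hasDerivAt_rpow_const (Or.inl h0)).mul
      (((hasDerivAt_id y).const_sub 1).rpow_const (Or.inl h1))).mul (hasDerivAt_hyper hm hy1)).sub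
      ((hasDerivAt_incBeta hm hm y).const_mul m)).congr_deriv ?_
    have ode := hyper_ode hm hy1
    set D := ∑' k : ℕ, ((k : ℝ) + 1) * hyperCoeff m (k + 1) * y ^ k
    simp only [id, Pi.mul_apply]
    rw [Real.rpow_sub_one h0, Real.rpow_sub_one h1]
    field_simp
    linear_combination y ^ m * (1 - y) ^ m * ode
  obtain ⟨c, -, h⟩ := exists_hasDerivAt_eq_slope _ _ hx.1 hc hd
  rw [eq_div_iff (by linarith [hx.1]), incBeta_zero, Real.zero_rpow (by linarith)] at h
  linarith

lemma incBeta_mul_hyper_comm {m x : ℝ} (hm : 1 ≤ m) (hx : x ∈ Set.Ioo 0 1) :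
    incBeta (1 - x) m m * hyper m x = incBeta x m m * hyper m (1 - x) := by
  have h1 := rpow_mul_hyper_eq_incBeta hm hx
  have h2 := rpow_mul_hyper_eq_incBeta hm (x := 1 - x) ⟨by linarith [hx.2], by linarith [hx.1]⟩
  rw [sub_sub_cancel] at h2
  have hm0 : m ≠ 0 := by linarith
  refine mul_left_cancel₀ hm0 ?_
  linear_combination hyper m (1 - x) * h1 - hyper m x * h2

lemma hyperPrim_nonneg {m x : ℝ} (hm : 1 ≤ m) (hx : 0 ≤ x) : 0 ≤ hyperPrim m x :=
  tsum_nonneg fun k => mul_nonneg (primCoeff_pos hm k).le (by positivity)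

lemma hyperPrim_zero (m : ℝ) : hyperPrim m 0 = 0 := by simp [hyperPrim]

lemma hyperPrim_mono {m x y : ℝ} (hm : 1 ≤ m) (hx : 0 ≤ x) (hxy : x ≤ y) (hy : y < 1) :
    hyperPrim m x ≤ hyperPrim m y := by
  have h1 : |x| < 1 := abs_lt.2 ⟨by linarith, by linarith⟩
  have h2 : |y| < 1 := abs_lt.2 ⟨by linarith, by linarith⟩
  refine (summable_primCoeff_mul_pow hm h1).tsum_le_tsum (fun k => ?_)
    (summable_primCoeff_mul_pow hm h2)
  have := primCoeff_pos hm k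
  gcongr

lemma weightedPrim_one_le {m x : ℝ} (hm : 1 ≤ m) (hx : x ∈ Set.Ioo 0 1) :
    weightedPrim m 1 ≤ incBeta (1 - x) m m * hyperPrim m x + incBeta x m m * hyperPrim m (1 - x)
      + weightedPrim m (1 - x) + weightedPrim m x := by
  set ψ : ℝ → ℝ := fun x => incBeta (1 - x) m m * hyperPrim m x
    + incBeta x m m * hyperPrim m (1 - x) + weightedPrim m (1 - x) + weightedPrim m x with hψ
  have hd : ∀ y ∈ Set.Ioo (0 : ℝ) 1, HasDerivAt ψ 0 y := by
    intro y hy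
    have hy' : 1 - y ∈ Set.Ioo (0 : ℝ) 1 := ⟨by linarith [hy.2], by linarith [hy.1]⟩
    refine (((((hasDerivAt_incBeta_one_sub hm y).mul
      (hasDerivAt_hyperPrim hm (abs_lt_one_of_mem_Ioo hy))).add
      ((hasDerivAt_incBeta hm hm y).mul
        ((hasDerivAt_hyperPrim hm (abs_lt_one_of_mem_Ioo hy')).comp_const_sub 1 y))).add
      (hasDerivAt_weightedPrim_one_sub hm hy)).add (hasDerivAt_weightedPrim hm hy)).congr_deriv ?_
    linear_combination incBeta_mul_hyper_comm hm hy
  have hconst : ∀ y ∈ Set.Ioo (0 : ℝ) 1, ψ y = ψ x := fun y hy =>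
    isOpen_Ioo.is_const_of_deriv_eq_zero isPreconnected_Ioo
      (fun z hz => (hd z hz).differentiableAt.differentiableWithinAt)
      (fun z hz => (hd z hz).deriv) hy hx
  have hA := continuousOn_weightedPrim hm
  have hlim : Tendsto (fun y => incBeta (1 - y) m m * hyperPrim m y + weightedPrim m (1 - y)
      + weightedPrim m y) (nhdsWithin 0 (Set.Ioo 0 1)) (nhds (weightedPrim m 1)) := by
    have hc : ContinuousWithinAt (fun y => incBeta (1 - y) m m * hyperPrim m y
        + weightedPrim m (1 - y) + weightedPrim m y) (Set.Icc 0 1) 0 := by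
      refine ((ContinuousWithinAt.mul (hasDerivAt_incBeta_one_sub hm 0).continuousAt.continuousWithinAt
        (hasDerivAt_hyperPrim hm (by simp)).continuousAt.continuousWithinAt).add
        (ContinuousWithinAt.comp (t := Set.Icc 0 1) (hA _ (by simp))
          (continuous_const.sub continuous_id).continuousWithinAt fun y hy => ?_)).add
        (hA 0 (by simp))
      exact ⟨by simpa using hy.2, by simpa using hy.1⟩
    have h := (hc.mono Set.Ioo_subset_Icc_self).tendsto
    simpa [hyperPrim_zero, weightedPrim_zero] using h
  have : (nhdsWithin (0 : ℝ) (Set.Ioo 0 1)).NeBot := left_nhdsWithin_Ioo_neBot zero_lt_one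
  refine le_of_tendsto hlim ?_
  filter_upwards [self_mem_nhdsWithin] with y hy
  refine le_trans ?_ (hconst y hy).le
  have := mul_nonneg (incBeta_nonneg hm hm ⟨hy.1.le, hy.2.le⟩)
    (hyperPrim_nonneg hm (sub_nonneg.2 hy.2.le))
  simp only [hψ]
  linarith

lemma weightedPrim_one_le_of_mem {m x s : ℝ} (hm : 1 ≤ m) (hx : x ∈ Set.Ioo 0 1)
    (hs : s ∈ Set.Ioo 0 1) :
    weightedPrim m 1 ≤ incBeta s m m * hyperPrim m x + incBeta (1 - s) m m * hyperPrim m (1 - x)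
      + weightedPrim m s + weightedPrim m (1 - s) := by
  set Φ : ℝ → ℝ := fun s => incBeta s m m * hyperPrim m x
    + incBeta (1 - s) m m * hyperPrim m (1 - x) + weightedPrim m s + weightedPrim m (1 - s) with hΦ
  have hx' : 1 - x ∈ Set.Ioo (0 : ℝ) 1 := ⟨by linarith [hx.2], by linarith [hx.1]⟩
  have hd : ∀ y ∈ Set.Ioo (0 : ℝ) 1, HasDerivAt Φ (y ^ (m - 1) * (1 - y) ^ (m - 1) *
      ((hyperPrim m x - hyperPrim m (1 - y)) + (hyperPrim m y - hyperPrim m (1 - x)))) y := by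
    intro y hy
    refine (((((hasDerivAt_incBeta hm hm y).mul_const _).add
      ((hasDerivAt_incBeta_one_sub hm y).mul_const _)).add
      (hasDerivAt_weightedPrim hm hy)).add (hasDerivAt_weightedPrim_one_sub hm hy)).congr_deriv ?_
    ring
  have hmin : weightedPrim m 1 ≤ Φ (1 - x) := by
    have := weightedPrim_one_le hm hx
    simp only [hΦ, sub_sub_cancel]
    linarith
  refine hmin.trans ?_
  rcases le_total s (1 - x) with h | h
  · have hsub : Set.Icc s (1 - x) ⊆ Set.Ioo 0 1 := Set.Icc_subset_Ioo hs.1 hx'.2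
    refine antitoneOn_of_deriv_nonpos (convex_Icc s (1 - x))
      (fun y hy => (hd y (hsub hy)).continuousAt.continuousWithinAt)
      (fun y hy => (hd y (hsub (interior_subset hy))).differentiableAt.differentiableWithinAt)
      (fun y hy => ?_) (Set.left_mem_Icc.2 h) (Set.right_mem_Icc.2 h) h
    replace hy := interior_subset hy
    have hy1 := hsub hy
    rw [(hd y hy1).deriv]
    refine mul_nonpos_of_nonneg_of_nonpos (mul_nonneg (Real.rpow_nonneg hy1.1.le _)
      (Real.rpow_nonneg (sub_nonneg.2 hy1.2.le) _)) ?_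
    have h1 := hyperPrim_mono hm hx.1.le (show x ≤ 1 - y by linarith [hy.2]) (by linarith [hy1.1])
    have h2 := hyperPrim_mono hm hy1.1.le hy.2 hx'.2
    linarith
  · have hsub : Set.Icc (1 - x) s ⊆ Set.Ioo 0 1 := Set.Icc_subset_Ioo hx'.1 hs.2
    refine monotoneOn_of_deriv_nonneg (convex_Icc (1 - x) s)
      (fun y hy => (hd y (hsub hy)).continuousAt.continuousWithinAt)
      (fun y hy => (hd y (hsub (interior_subset hy))).differentiableAt.differentiableWithinAt)
      (fun y hy => ?_) (Set.left_mem_Icc.2 h) (Set.right_mem_Icc.2 h) h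
    replace hy := interior_subset hy
    have hy1 := hsub hy
    rw [(hd y hy1).deriv]
    refine mul_nonneg (mul_nonneg (Real.rpow_nonneg hy1.1.le _)
      (Real.rpow_nonneg (sub_nonneg.2 hy1.2.le) _)) ?_
    have h1 := hyperPrim_mono hm (sub_nonneg.2 hy1.2.le) (show 1 - y ≤ x by linarith [hy.1]) hx.2
    have h2 := hyperPrim_mono hm hx'.1.le hy.1 hy1.2
    linarith

lemma poch_div_eq_primCoeff (n k : ℕ) :
    poch n k / (((k : ℝ) + 1) * poch ((n : ℝ) / 2 + 1) k) = primCoeff ((n : ℝ) / 2) k := by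
  rw [primCoeff, hyperCoeff, div_div, mul_div_cancel₀ _ two_ne_zero, mul_comm ((k : ℝ) + 1)]

lemma green_eq {n : ℕ} (hn : 2 ≤ n) {t : ℝ} (ht : 1 - t ^ 2 / 4 ∈ Set.Ioo (0 : ℝ) 1) :
    green n t = 2 / (n * sphereVol n) * (hyperPrim ((n : ℝ) / 2) (1 - t ^ 2 / 4) -
      weightedPrim ((n : ℝ) / 2) 1 / incBeta 1 ((n : ℝ) / 2) ((n : ℝ) / 2)) := by
  have hm : 1 ≤ (n : ℝ) / 2 := by
    have : (2 : ℝ) ≤ n := by exact_mod_cast hn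
    linarith
  rw [green, hyperPrim, weightedPrim, ← tsum_div_const,
    ← (summable_primCoeff_mul_pow hm (abs_lt_one_of_mem_Ioo ht)).tsum_sub
      ((summable_primCoeff_mul_incBeta_one hm).div_const _)]
  congr 1
  refine tsum_congr fun k => ?_
  rw [poch_div_eq_primCoeff, incBeta_one_comm _ ((n : ℝ) / 2 + k + 1)]
  ring

lemma Kfun_eq (n : ℕ) (a : ℝ) :
    Kfun n a = 2 / (n * sphereVol n) * (weightedPrim ((n : ℝ) / 2) (Real.sin (a / 2) ^ 2) /
      incBeta (Real.sin (a / 2) ^ 2) ((n : ℝ) / 2) ((n : ℝ) / 2)) := by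
  rw [Kfun, weightedPrim, ← tsum_div_const]
  congr 1
  refine tsum_congr fun k => ?_
  rw [mul_comm (poch _ k) ((k : ℝ) + 1), poch_div_eq_primCoeff, mul_div_assoc]

lemma sphereVol_pos (n : ℕ) : 0 < sphereVol n := by
  have := Real.Gamma_pos_of_pos (show 0 < ((n : ℝ) + 1) / 2 by positivity)
  rw [sphereVol]
  positivity

theorem stmt_15 (n : ℕ) (hn : 2 ≤ n) (t a : ℝ) (ht : t ∈ Set.Ioo 0 2) (ha : a ∈ Set.Ioo 0 π) :
    0 ≤ green n t + Kfun n a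
        + incBeta (Real.cos (a / 2) ^ 2) ((n : ℝ) / 2) ((n : ℝ) / 2) /
            incBeta (Real.sin (a / 2) ^ 2) ((n : ℝ) / 2) ((n : ℝ) / 2)
          * (green n (Real.sqrt (4 - t ^ 2)) + Kfun n (π - a)) := by
  have hm : 1 ≤ (n : ℝ) / 2 := by
    have : (2 : ℝ) ≤ n := by exact_mod_cast hn
    linarith
  have hx : 1 - t ^ 2 / 4 ∈ Set.Ioo (0 : ℝ) 1 :=
    ⟨by nlinarith [ht.1, ht.2], by nlinarith [ht.1]⟩
  have hsq : Real.sqrt (4 - t ^ 2) ^ 2 = 4 - t ^ 2 := Real.sq_sqrt (by nlinarith [ht.1, ht.2])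
  have hx1 : 1 - Real.sqrt (4 - t ^ 2) ^ 2 / 4 = 1 - (1 - t ^ 2 / 4) := by
    rw [hsq]
    ring
  have hx' : 1 - (1 - t ^ 2 / 4) ∈ Set.Ioo (0 : ℝ) 1 :=
    ⟨by linarith [hx.2], by linarith [hx.1]⟩
  have hsin : 0 < Real.sin (a / 2) := Real.sin_pos_of_pos_of_lt_pi (by linarith [ha.1])
    (by linarith [ha.2, Real.pi_pos])
  have hcos : 0 < Real.cos (a / 2) := Real.cos_pos_of_mem_Ioo
    ⟨by linarith [ha.1, Real.pi_pos], by linarith [ha.2]⟩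
  have hcs : Real.cos (a / 2) ^ 2 = 1 - Real.sin (a / 2) ^ 2 := Real.cos_sq' _
  have hsc : Real.sin ((π - a) / 2) ^ 2 = 1 - Real.sin (a / 2) ^ 2 := by
    rw [← hcs, sub_div, Real.sin_pi_div_two_sub]
  have hs : Real.sin (a / 2) ^ 2 ∈ Set.Ioo (0 : ℝ) 1 := ⟨by positivity, by nlinarith⟩
  rw [Kfun_eq, Kfun_eq, hsc, hcs, green_eq hn hx, green_eq hn (by rwa [hx1]), hx1]
  have hC : 0 ≤ 2 / (n * sphereVol n) := by
    have := sphereVol_pos n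
    positivity
  generalize 2 / (n * sphereVol n) = C at hC ⊢
  generalize (n : ℝ) / 2 = m at *
  generalize 1 - t ^ 2 / 4 = x at *
  generalize Real.sin (a / 2) ^ 2 = s at *
  have key := weightedPrim_one_le_of_mem hm hx hs
  have hadd := incBeta_add_incBeta_one_sub hm s
  have hW : 0 < incBeta s m m := incBeta_pos hm hm ⟨hs.1, hs.2.le⟩
  have hW' : 0 < incBeta (1 - s) m m :=
    incBeta_pos hm hm ⟨by linarith [hs.2], by linarith [hs.1]⟩
  rw [← hadd]
  have e : ∀ {U V f g A B T : ℝ}, 0 < U → 0 < V →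
      C * (f - T / (U + V)) + C * (A / U) + V / U * (C * (g - T / (U + V)) + C * (B / V)) =
        C / U * (U * f + V * g + A + B - T) := fun hU hV => by
    have := (add_pos hU hV).ne'
    field_simp
    ring
  rw [e hW hW']
  exact mul_nonneg (div_nonneg hC hW.le) (by linarith)
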